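/- arXiv:2302.05202 — 4 statements merged into one kernel-verified Lean document; each statement's English description precedes it below -/
import Mathlib

section
/- Let c, δ, γ be complex numbers with c ≠ 1. If the polynomial identity c(X³ − 1) − (X − δ)³ = (c − 1)(X − γ)³ holds (equivalently, the two sides agree for every X ∈ ℂ), then δ = γ. -/
/-- If `c ≠ 1` and the polynomial identity
`c(X³ − 1) − (X − δ)³ = (c − 1)(X − γ)³` holds for every `X ∈ ℂ`, then `δ = γ`. -/
theorem stmt_10 (c δ γ : ℂ) (hc : c ≠ 1)
    (h : ∀ X : ℂ, c * (X ^ 3 - 1) - (X - δ) ^ 3 = (c - 1) * (X - γ) ^ 3) :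
    δ = γ := by
  have h0 := h 0
  have h1 := h 1
  have h2 := h (-1)
  have e2 : δ = -(c - 1) * γ := by linear_combination (h1 + h2 - 2 * h0) / 6
  have e1 : δ ^ 2 = -(c - 1) * γ ^ 2 := by linear_combination (h2 - h1) / 6
  have e : δ * (δ - γ) = 0 := by linear_combination e1 - γ * e2
  rcases mul_eq_zero.mp e with hd | hd
  · have hg : (c - 1) * γ = 0 := by linear_combination e2 - hd
    rcases mul_eq_zero.mp hg with hg | hg
    · exact absurd (sub_eq_zero.mp hg) hc
    · rw [hd, hg]
  · exact sub_eq_zero.mp hd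
end

section
/- Let c, κ, δ, γ be complex numbers with c ≠ 0, κ ≠ 1 and c ≠ κ². Suppose that both polynomial identities c(X−1)(X−κ) − (X−δ)² = (c−1)(X+1)(X+κ) and c(X−1)(X−κ) − κ²(X−δ)² = (c−κ²)(X−γ)² hold for every X ∈ ℂ. Then κ = δ², γ = −δ, 2c(1+δ²) = (1+δ)², and 8δ⁵(δ²+1) = (δ+1)⁴. -/
/-- If `c ≠ 0`, `κ ≠ 1`, `c ≠ κ²` and the two polynomial identities
`c(X−1)(X−κ) − (X−δ)² = (c−1)(X+1)(X+κ)` and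
`c(X−1)(X−κ) − κ²(X−δ)² = (c−κ²)(X−γ)²` hold for every `X ∈ ℂ`, then
`κ = δ²`, `γ = −δ`, `2c(1+δ²) = (1+δ)²` and `8δ⁵(δ²+1) = (δ+1)⁴`. -/
theorem stmt_11 (c κ δ γ : ℂ) (hc : c ≠ 0) (hκ : κ ≠ 1) (hcκ : c ≠ κ ^ 2)
    (h1 : ∀ X : ℂ, c * (X - 1) * (X - κ) - (X - δ) ^ 2 = (c - 1) * (X + 1) * (X + κ))
    (h2 : ∀ X : ℂ, c * (X - 1) * (X - κ) - κ ^ 2 * (X - δ) ^ 2 = (c - κ ^ 2) * (X - γ) ^ 2) :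
    κ = δ ^ 2 ∧ γ = -δ ∧ 2 * c * (1 + δ ^ 2) = (1 + δ) ^ 2 ∧
      8 * δ ^ 5 * (δ ^ 2 + 1) = (δ + 1) ^ 4 := by
  have a : κ = δ ^ 2 := by linear_combination h1 0
  subst a
  have b : 2 * c * (1 + δ ^ 2) = (1 + δ) ^ 2 := by
    linear_combination h1 0 - h1 1
  have hd : c - (δ ^ 2) ^ 2 ≠ 0 := sub_ne_zero.mpr hcκ
  have e : (c - (δ ^ 2) ^ 2) * ((γ - δ) * (γ + δ)) = 0 := by
    linear_combination -h2 0
  have l : -c * (1 + δ ^ 2) + 2 * δ ^ 5 = -2 * γ * (c - (δ ^ 2) ^ 2) := by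
    linear_combination h2 1 - h2 0
  have hg : γ = -δ := by
    rcases mul_eq_zero.mp ((mul_eq_zero.mp e).resolve_left hd) with h | h
    · exfalso
      have g : γ = δ := sub_eq_zero.mp h
      subst g
      have q : c * (γ - 1) ^ 2 = 0 := by linear_combination -l
      have r : γ - 1 = 0 := pow_eq_zero_iff (two_ne_zero) |>.mp ((mul_eq_zero.mp q).resolve_left hc)
      apply hκ
      linear_combination (γ + 1) * r
    · exact eq_neg_of_add_eq_zero_left h
  subst hg
  refine ⟨rfl, rfl, b, ?_⟩
  linear_combination 2 * (1 + δ ^ 2) * l + (1 + δ) ^ 2 * b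
end

section
/- Let c, δ, γ₁, γ₂ be complex numbers with c ≠ 0, δ ≠ 0, δ⁴ ≠ 1, c ≠ δ², and c ≠ δ^{−2}. Suppose that both polynomial identities c(X−δ)(X−δ^{−1}) − δ²(X+δ)(X+δ^{−1}) = (c−δ²)(X−γ₁)² and c(X−δ)(X−δ^{−1}) − δ^{−2}(X+δ)(X+δ^{−1}) = (c−δ^{−2})(X−γ₂)² hold for every X ∈ ℂ. Then γ₁² = 1, γ₂² = 1, c² = 1, and d := δ + δ^{−1} satisfies d²(d² − 4) = 2(1−c)d² − 8(1+c). -/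
/-- Suppose `c ≠ 0`, `δ ≠ 0`, `δ⁴ ≠ 1`, `c ≠ δ²`, `c ≠ δ⁻²`, and the two
polynomial identities
`c(X−δ)(X−δ⁻¹) − δ²(X+δ)(X+δ⁻¹) = (c−δ²)(X−γ₁)²` and
`c(X−δ)(X−δ⁻¹) − δ⁻²(X+δ)(X+δ⁻¹) = (c−δ⁻²)(X−γ₂)²`
hold for every `X ∈ ℂ`.  Then `γ₁² = 1`, `γ₂² = 1`, `c² = 1`, and `d = δ + δ⁻¹`
satisfies `d²(d² − 4) = 2(1−c)d² − 8(1+c)`. -/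
theorem stmt_14 (c δ γ₁ γ₂ : ℂ) (hc : c ≠ 0) (hδ : δ ≠ 0) (hδ4 : δ ^ 4 ≠ 1)
    (hc1 : c ≠ δ ^ 2) (hc2 : c ≠ (δ ^ 2)⁻¹)
    (h1 : ∀ X : ℂ, c * (X - δ) * (X - δ⁻¹) - δ ^ 2 * (X + δ) * (X + δ⁻¹)
        = (c - δ ^ 2) * (X - γ₁) ^ 2)
    (h2 : ∀ X : ℂ, c * (X - δ) * (X - δ⁻¹) - (δ ^ 2)⁻¹ * (X + δ) * (X + δ⁻¹)
        = (c - (δ ^ 2)⁻¹) * (X - γ₂) ^ 2) :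
    γ₁ ^ 2 = 1 ∧ γ₂ ^ 2 = 1 ∧ c ^ 2 = 1 ∧
      (δ + δ⁻¹) ^ 2 * ((δ + δ⁻¹) ^ 2 - 4)
        = 2 * (1 - c) * (δ + δ⁻¹) ^ 2 - 8 * (1 + c) := by
  have a0 := h1 0
  have a1 := h1 1
  have b0 := h2 0
  have b1 := h2 1
  have he : δ * δ⁻¹ = 1 := mul_inv_cancel₀ hδ
  rw [← inv_pow] at hc2 b0 b1
  generalize δ⁻¹ = e at *
  have n1 : c - δ ^ 2 ≠ 0 := sub_ne_zero.2 hc1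
  have n2 : c - e ^ 2 ≠ 0 := sub_ne_zero.2 hc2
  have g1 : γ₁ ^ 2 = 1 := by
    apply mul_left_cancel₀ n1
    linear_combination -a0 + (c - δ ^ 2) * he
  have g2 : γ₂ ^ 2 = 1 := by
    apply mul_left_cancel₀ n2
    linear_combination -b0 + (c - e ^ 2) * he
  have l1 : (c + δ ^ 2) * (δ + e) = 2 * (c - δ ^ 2) * γ₁ := by
    linear_combination a0 - a1
  have l2 : (c + e ^ 2) * (δ + e) = 2 * (c - e ^ 2) * γ₂ := by
    linear_combination b0 - b1
  have q1 : (c + δ ^ 2) ^ 2 * (δ + e) ^ 2 = 4 * (c - δ ^ 2) ^ 2 := by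
    rw [← mul_pow, l1]
    linear_combination 4 * (c - δ ^ 2) ^ 2 * g1
  have q2 : (c + e ^ 2) ^ 2 * (δ + e) ^ 2 = 4 * (c - e ^ 2) ^ 2 := by
    rw [← mul_pow, l2]
    linear_combination 4 * (c - e ^ 2) ^ 2 * g2
  -- clear denominators, with `s = δ ^ 2`
  have p1 : c ^ 2 * (δ ^ 2 - 1) ^ 2 + 2 * c * δ ^ 2 * ((δ ^ 2 + 1) ^ 2 + 4 * δ ^ 2)
      + δ ^ 4 * (δ ^ 2 - 1) ^ 2 = 0 := by
    have : e = δ⁻¹ := eq_inv_of_mul_eq_one_right he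
    subst this
    field_simp at q1
    linear_combination q1
  have p2 : c ^ 2 * δ ^ 4 * (δ ^ 2 - 1) ^ 2 + 2 * c * δ ^ 2 * ((δ ^ 2 + 1) ^ 2 + 4 * δ ^ 2)
      + (δ ^ 2 - 1) ^ 2 = 0 := by
    have : e = δ⁻¹ := eq_inv_of_mul_eq_one_right he
    subst this
    field_simp at q2
    linear_combination q2
  have m1 : δ ^ 4 - 1 ≠ 0 := sub_ne_zero.2 hδ4
  have m2 : δ ^ 2 - 1 ≠ 0 := fun h => m1 (by linear_combination (δ ^ 2 + 1) * h)
  have hcc : c ^ 2 = 1 := by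
    apply mul_left_cancel₀ (mul_ne_zero m1 (pow_ne_zero 2 m2))
    linear_combination p2 - p1
  refine ⟨g1, g2, hcc, ?_⟩
  have : e = δ⁻¹ := eq_inv_of_mul_eq_one_right he
  subst this
  field_simp
  linear_combination p1 - (δ ^ 2 - 1) ^ 2 * hcc
end

section
/- Let δ be a complex number and let x, y be complex numbers with x ≠ 0, y ≠ 0 and x² − 2δx + 1 ≠ 0. Put f = (x + 1/x)/2, F = (y + 1/y)/2, and Q = (δx² − 2x + δ)/(x² − 2δx + 1). If F² = 1 − ((δf − 1)/(f − δ))² (note that f − δ = (x² − 2δx + 1)/(2x) ≠ 0), then y² + 2iQy − 1 = 0 or y² − 2iQy − 1 = 0. -/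
/-- Let `x ≠ 0`, `y ≠ 0`, `x² − 2δx + 1 ≠ 0`, and put
`f = (x + 1/x)/2`, `F = (y + 1/y)/2`, `Q = (δx² − 2x + δ)/(x² − 2δx + 1)`.
If `F² = 1 − ((δf − 1)/(f − δ))²`, then `y² + 2iQy − 1 = 0` or `y² − 2iQy − 1 = 0`. -/
theorem stmt_18 (δ x y : ℂ) (hx : x ≠ 0) (hy : y ≠ 0)
    (hden : x ^ 2 - 2 * δ * x + 1 ≠ 0)
    (f F Q : ℂ)
    (hf : f = (x + x⁻¹) / 2) (hF : F = (y + y⁻¹) / 2)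
    (hQ : Q = (δ * x ^ 2 - 2 * x + δ) / (x ^ 2 - 2 * δ * x + 1))
    (h : F ^ 2 = 1 - ((δ * f - 1) / (f - δ)) ^ 2) :
    y ^ 2 + 2 * Complex.I * Q * y - 1 = 0 ∨ y ^ 2 - 2 * Complex.I * Q * y - 1 = 0 := by
  have e1 : δ * f - 1 = (δ * x ^ 2 - 2 * x + δ) / (2 * x) := by
    rw [hf]; field_simp; ring
  have e2 : f - δ = (x ^ 2 - 2 * δ * x + 1) / (2 * x) := by
    rw [hf]; field_simp; ring
  have h2x : (2 * x) ≠ 0 := mul_ne_zero two_ne_zero hx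
  have e3 : (δ * f - 1) / (f - δ) = Q := by
    rw [e1, e2, hQ, div_div_div_cancel_right₀ h2x]
  rw [e3] at h
  have e4 : 2 * y * F = y ^ 2 + 1 := by
    rw [hF]; field_simp
  rw [← mul_eq_zero]
  linear_combination (4 * y ^ 2) * h - (2 * y * F + y ^ 2 + 1) * e4
    - 4 * Q ^ 2 * y ^ 2 * Complex.I_sq
end
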